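/- arXiv:2512.01064 — 2 statements merged into one kernel-verified Lean document; each statement's English description precedes it below -/
import Mathlib

section
/- Assume all travel times are nonnegative. Let R' be a partial route that is feasible for t_0 ≥ 0, and let R be a suffix of R' whose first vertex is v. Then R is feasible for max{t_0, a(v)} and δ(R', t_0) ≥ δ(R, max{t_0, a(v)}). In particular, if δ(R, max{t_0, a(v)}) ≥ ub for some ub, then every partial route with suffix R that is feasible for t_0 has arrival time at least ub. -/
noncomputable section

attribute [local instance] Classical.propDecidable

/-- `delta τ a r t i`: earliest arrival time at the `i`-th vertex of the partial route
`⟨r 0, …, r k⟩` when the vehicle departs from `r 0` at time `t`, taking waiting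
times (lower time-window bounds `a`) into account. -/
def delta (τ : ℕ → ℕ → ℝ) (a : ℕ → ℝ) (r : ℕ → ℕ) (t : ℝ) : ℕ → ℝ
  | 0 => max t (a (r 0))
  | i + 1 => max (delta τ a r t i + τ (r i) (r (i + 1))) (a (r (i + 1)))

/-- The partial route `⟨r 0, …, r k⟩` is feasible for departure time `t`:
the departure is not before `a (r 0)` and every vertex is reached before the
end `b` of its time window. -/
def Feasible (τ : ℕ → ℕ → ℝ) (a b : ℕ → ℝ) (r : ℕ → ℕ) (k : ℕ) (t : ℝ) : Prop :=
  a (r 0) ≤ t ∧ ∀ i ≤ k, delta τ a r t i ≤ b (r i)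

/-- Nonnegative travel times make the earliest departure time a lower bound on every arrival. -/
theorem le_delta {τ : ℕ → ℕ → ℝ} (hτ : ∀ x y, 0 ≤ τ x y) (a : ℕ → ℝ) (r : ℕ → ℕ) (t : ℝ)
    (i : ℕ) : t ≤ delta τ a r t i := by
  induction i with
  | zero => exact le_max_left _ _
  | succ i ih => exact le_max_of_le_left (le_add_of_le_of_nonneg ih (hτ _ _))

theorem window_le_delta (τ : ℕ → ℕ → ℝ) (a : ℕ → ℝ) (r : ℕ → ℕ) (t : ℝ) (i : ℕ) :
    a (r i) ≤ delta τ a r t i := by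
  cases i <;> exact le_max_right _ _

/-- Starting at a suffix directly is never later than reaching it along the whole route. -/
theorem delta_suffix_le {τ : ℕ → ℕ → ℝ} (hτ : ∀ x y, 0 ≤ τ x y) (a : ℕ → ℝ)
    {r r' : ℕ → ℕ} {k d : ℕ} (hsuf : ∀ m ≤ k, r' (d + m) = r m) (t : ℝ) {i : ℕ} (hi : i ≤ k) :
    delta τ a r (max t (a (r 0))) i ≤ delta τ a r' t (d + i) := by
  induction i with
  | zero =>
    have h := window_le_delta τ a r' t (d + 0)
    rw [hsuf 0 hi] at h
    exact max_le (max_le (le_delta hτ a r' t _) h) h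
  | succ i ih =>
    have hi' : i ≤ k := Nat.le_of_succ_le hi
    rw [← Nat.add_assoc]
    simp only [delta]
    rw [Nat.add_assoc, hsuf _ hi, hsuf _ hi']
    exact max_le_max_right _ (by grw [ih hi'])

/-- With nonnegative travel times, if `R'` is feasible for `t0 ≥ 0` and `R` is a suffix
of `R'` with first vertex `v = r 0`, then `R` is feasible for `max t0 (a (r 0))` and
`δ(R', t0) ≥ δ(R, max t0 (a (r 0)))`.  In particular, if
`δ(R, max t0 (a (r 0))) ≥ ub`, then every partial route with suffix `R` that is
feasible for `t0` has arrival time at least `ub`. -/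
theorem stmt8 (τ : ℕ → ℕ → ℝ) (a b : ℕ → ℝ) (hτ : ∀ x y, 0 ≤ τ x y)
    (r : ℕ → ℕ) (k : ℕ) (r' : ℕ → ℕ) (d : ℕ) (t0 : ℝ) (ht0 : 0 ≤ t0)
    (hsuf : ∀ m ≤ k, r' (d + m) = r m)
    (hf : Feasible τ a b r' (d + k) t0) :
    Feasible τ a b r k (max t0 (a (r 0))) ∧
      delta τ a r (max t0 (a (r 0))) k ≤ delta τ a r' t0 (d + k) ∧
      ∀ ub : ℝ, ub ≤ delta τ a r (max t0 (a (r 0))) k →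
        ∀ (u : ℕ → ℕ) (e : ℕ), (∀ m ≤ k, u (e + m) = r m) →
          Feasible τ a b u (e + k) t0 → ub ≤ delta τ a u t0 (e + k) := by
  refine ⟨⟨le_max_right _ _, fun i hi => ?_⟩, delta_suffix_le hτ a hsuf t0 le_rfl,
    fun ub hub u e hu _ => hub.trans (delta_suffix_le hτ a hu t0 le_rfl)⟩
  rw [← hsuf i hi]
  exact (delta_suffix_le hτ a hsuf t0 hi).trans (hf.2 _ (Nat.add_le_add_left hi d))
end
end

section
/- Assume that all travel times τ(v, w), all time window endpoints a(v), b(v), and the horizon T are integers. Let R be a partial route that is feasible for some t ∈ [0, T]. Then: (i) for every integer departure time t and every position i, δ(R, t, i) is an integer; (ii) the maximum t_max of {t ∈ [0, T] : R is feasible for t} is an integer; and (iii) the duration satisfies Δ(R) = min{δ(R, t) − t : t ∈ [0, T] ∩ ℤ, R is feasible for t} and Δ(R) ∈ ℤ. -/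
noncomputable section

attribute [local instance] Classical.propDecidable

/-- With integral data, the arrival time at each vertex is the maximum of an integral shift of the
departure time and an integral constant. -/
theorem exists_delta_eq_max {τ : ℕ → ℕ → ℝ} {a : ℕ → ℝ} (hτ : ∀ x y, ∃ m : ℤ, τ x y = m)
    (ha : ∀ x, ∃ m : ℤ, a x = m) (r : ℕ → ℕ) (i : ℕ) :
    ∃ c d : ℤ, ∀ t : ℝ, delta τ a r t i = max (t + c) d := by
  induction i with
  | zero =>
    obtain ⟨m, hm⟩ := ha (r 0)
    exact ⟨0, m, fun t => by simp [delta, hm]⟩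
  | succ i ih =>
    obtain ⟨c, d, h⟩ := ih
    obtain ⟨m, hm⟩ := ha (r (i + 1))
    obtain ⟨p, hp⟩ := hτ (r i) (r (i + 1))
    refine ⟨c + p, max (d + p) m, fun t => ?_⟩
    simp only [delta, h, hm, hp]
    push_cast
    rw [max_add_add_right (t + c : ℝ) d p |>.symm, max_assoc, add_assoc]

/-- Departing later does not increase the time spent on a partial route. -/
theorem antitone_delta_sub (τ : ℕ → ℕ → ℝ) (a : ℕ → ℝ) (r : ℕ → ℕ) (i : ℕ) :
    Antitone fun t => delta τ a r t i - t := by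
  intro s t hst
  simp only
  induction i with
  | zero => simp only [delta]; grind
  | succ i ih => simp only [delta]; grind

/-- With integral data, feasibility is preserved by rounding the departure time up. -/
theorem Feasible.ceil {τ : ℕ → ℕ → ℝ} {a b : ℕ → ℝ} (hτ : ∀ x y, ∃ m : ℤ, τ x y = m)
    (ha : ∀ x, ∃ m : ℤ, a x = m) (hb : ∀ x, ∃ m : ℤ, b x = m) {r : ℕ → ℕ} {k : ℕ} {t : ℝ}
    (h : Feasible τ a b r k t) : Feasible τ a b r k (⌈t⌉ : ℤ) := by
  refine ⟨h.1.trans (Int.le_ceil t), fun i hi => ?_⟩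
  obtain ⟨c, d, hδ⟩ := exists_delta_eq_max hτ ha r i
  obtain ⟨m, hm⟩ := hb (r i)
  have hle := h.2 i hi
  rw [hδ, hm, max_le_iff] at hle ⊢
  refine ⟨?_, hle.2⟩
  have hceil : ⌈t⌉ ≤ m - c := Int.ceil_le.2 (by push_cast; linarith)
  exact_mod_cast le_sub_iff_add_le.1 hceil

/-- Integrality: if all travel times, time-window endpoints and the horizon are
integers and `R` is feasible for some `t ∈ [0, T]`, then (i) `δ(R, t, i)` is an
integer for every integer departure time `t` and every position `i`; (ii) the
maximum feasible departure time within `[0, T]` is an integer; and (iii) the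
duration `Δ(R)` equals the minimum of `δ(R, t) − t` over the integer feasible
departure times in `[0, T]`, and `Δ(R)` is an integer. -/
theorem stmt16 (τ : ℕ → ℕ → ℝ) (a b : ℕ → ℝ) (T : ℝ)
    (hτZ : ∀ x y, ∃ m : ℤ, τ x y = m) (haZ : ∀ x, ∃ m : ℤ, a x = m)
    (hbZ : ∀ x, ∃ m : ℤ, b x = m) (hTZ : ∃ m : ℤ, T = m)
    (hab : ∀ x, a x ≤ b x) (hT : 0 ≤ T) (hwin : ∀ x, 0 ≤ a x ∧ b x ≤ T)
    (r : ℕ → ℕ) (k : ℕ)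
    (hne : ∃ t ∈ Set.Icc (0 : ℝ) T, Feasible τ a b r k t) :
    (∀ (t : ℤ) (i : ℕ), ∃ m : ℤ, delta τ a r (t : ℝ) i = m) ∧
      (∃ tmax : ℝ,
        IsGreatest {t : ℝ | t ∈ Set.Icc 0 T ∧ Feasible τ a b r k t} tmax ∧
          ∃ m : ℤ, tmax = m) ∧
      ∃ Δ : ℝ,
        IsLeast ((fun t => delta τ a r t k - t) ''
            {t : ℝ | t ∈ Set.Icc 0 T ∧ Feasible τ a b r k t}) Δ ∧
        IsLeast ((fun t => delta τ a r t k - t) ''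
            {t : ℝ | (t ∈ Set.Icc 0 T ∧ Feasible τ a b r k t) ∧ ∃ m : ℤ, t = m}) Δ ∧
        ∃ m : ℤ, Δ = m := by
  obtain ⟨N, rfl⟩ := hTZ
  have hround : ∀ t ∈ Set.Icc (0 : ℝ) N, Feasible τ a b r k t →
      ((⌈t⌉ : ℤ) : ℝ) ∈ Set.Icc (0 : ℝ) N ∧ Feasible τ a b r k (⌈t⌉ : ℤ) := fun t ht hf =>
    ⟨⟨ht.1.trans (Int.le_ceil t), by exact_mod_cast Int.ceil_le.2 ht.2⟩, hf.ceil hτZ haZ hbZ⟩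
  have hint : ∀ (t : ℤ) (i : ℕ), ∃ m : ℤ, delta τ a r (t : ℝ) i = m := by
    intro t i
    obtain ⟨c, d, h⟩ := exists_delta_eq_max hτZ haZ r i
    exact ⟨max (t + c) d, by rw [h]; push_cast; rfl⟩
  obtain ⟨t₀, ht₀, hf₀⟩ := hne
  obtain ⟨M, hM, hmax⟩ := Int.exists_greatest_of_bdd
    (P := fun z : ℤ => (z : ℝ) ∈ Set.Icc (0 : ℝ) N ∧ Feasible τ a b r k z)
    ⟨N, fun z hz => by exact_mod_cast hz.1.2⟩ ⟨⌈t₀⌉, hround t₀ ht₀ hf₀⟩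
  have hle : ∀ t ∈ Set.Icc (0 : ℝ) N, Feasible τ a b r k t → t ≤ M := fun t ht hf =>
    Int.ceil_le.1 (hmax _ (hround t ht hf))
  refine ⟨hint, ⟨M, ⟨hM, fun t ht => hle t ht.1 ht.2⟩, M, rfl⟩, delta τ a r M k - M,
    ⟨⟨M, hM, rfl⟩, ?_⟩, ⟨⟨M, ⟨hM, M, rfl⟩, rfl⟩, ?_⟩, ?_⟩
  · rintro _ ⟨t, ht, rfl⟩
    exact antitone_delta_sub τ a r k (hle t ht.1 ht.2)
  · rintro _ ⟨t, ⟨ht, -⟩, rfl⟩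
    exact antitone_delta_sub τ a r k (hle t ht.1 ht.2)
  · obtain ⟨m, hm⟩ := hint M k
    exact ⟨m - M, by rw [hm]; push_cast; rfl⟩
end
end
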